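/- Let K_1 and K_2 be number fields, regarded as subfields of a fixed algebraic closure of ℚ, with [K_1 : ℚ] = 2 and with K_2 a Galois extension of ℚ of odd degree d ≥ 3, whose discriminants are coprime, and let l ≥ 1 be an integer. Then there exists a sequence of complex coefficients u_n such that Σ_{n=1}^∞ |u_n| n^{−σ} < ∞ for every σ > 1/2, and for all s with Re(s) > 1, Σ_{n=1}^∞ a_{K_1}(n)^l a_{K_2}(n)^l/n^s = ζ_{K_1K_2}(s)^{(2d)^{l−1}} · Σ_{n=1}^∞ u_n/n^s, where K_1K_2 is the compositum of K_1 and K_2. -/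

import Mathlib

open NumberField Filter

/-- `aK K n` is the ideal counting function `a_K(n)`: the number of nonzero ideals of the
ring of integers of `K` with absolute norm `n`. -/
noncomputable def aK (K : Type) [Field K] [NumberField K] (n : ℕ) : ℕ :=
  Nat.card {I : Ideal (𝓞 K) // I ≠ ⊥ ∧ I.absNorm = n}

/-- The Dedekind zeta function of `K` as a Dirichlet series `ζ_K(s) = ∑ a_K(n) n^{-s}`
(valid in the half-plane of absolute convergence `Re s > 1`, which is where it is used). -/
noncomputable def dzeta (K : Type) [Field K] [NumberField K] (s : ℂ) : ℂ :=
  LSeries (fun n => (aK K n : ℂ)) s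


lemma aux_local_summable (A : ℕ) (c : ℕ) {r : ℝ} (h0 : 0 ≤ r) (h1 : r < 1) :
    Summable (fun k : ℕ => ((k : ℝ) + c) ^ A * r ^ k) := by
  by_cases hr : r = 0
  · subst hr
    refine summable_of_ne_finset_zero (s := {0}) ?_
    intro b hb
    simp at hb
    simp [hb]
  have h := summable_pow_mul_geometric_of_norm_lt_one (R := ℝ) A (r := r)
    (by rwa [Real.norm_of_nonneg h0])
  have h2 := ((summable_nat_add_iff c).2 h).mul_right ((r ^ c)⁻¹)
  refine h2.congr fun k => ?_
  push_cast
  rw [pow_add]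
  field_simp

set_option maxHeartbeats 1000000 in
lemma aux_analytic (f : ℕ → ℂ) (h1 : f 1 = 1)
    (hm : ∀ m n : ℕ, Nat.Coprime m n → f (m * n) = f m * f n)
    (A j N : ℕ) (hj : 1 ≤ j)
    (hb : ∀ p k : ℕ, p.Prime → ‖f (p ^ k)‖ ≤ ((k : ℝ) + 1) ^ A)
    (hv : ∀ p k : ℕ, p.Prime → N ≤ p → 1 ≤ k → k < j → f (p ^ k) = 0)
    (s : ℂ) (hs : 1 < j * s.re) : LSeriesSummable f s := by
  have hσ : 0 < s.re := by
    by_contra h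
    push Not at h
    have : (j : ℝ) * s.re ≤ 0 := mul_nonpos_of_nonneg_of_nonpos (by positivity) h
    linarith
  set σ := s.re with hσdef
  set g : ℕ → ℝ := fun n => ‖LSeries.term f s n‖ with hg
  have hgpow : ∀ p k : ℕ, p.Prime → g (p ^ k) = ‖f (p ^ k)‖ * ((p : ℝ) ^ (-σ)) ^ k := by
    intro p k hp
    have : (p ^ k) ≠ 0 := pow_ne_zero _ hp.ne_zero
    simp only [hg, LSeries.norm_term_eq, this, if_false]
    rw [div_eq_mul_inv, ← Real.rpow_neg (by positivity)]
    congr 1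
    push_cast
    rw [← Real.rpow_natCast, ← Real.rpow_natCast, ← Real.rpow_mul (by positivity),
      ← Real.rpow_mul (by positivity)]
    congr 1
    ring
  have hg1 : g 1 = 1 := by simp [hg, LSeries.term, h1]
  have hgm : ∀ {m n : ℕ}, Nat.Coprime m n → g (m * n) = g m * g n := by
    intro m n hmn
    simp only [hg]
    rw [← norm_mul]
    congr 1
    by_cases hm0 : m = 0
    · simp [hm0]
    by_cases hn0 : n = 0
    · simp [hn0]
    rw [LSeries.term_of_ne_zero (mul_ne_zero hm0 hn0), LSeries.term_of_ne_zero hm0,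
      LSeries.term_of_ne_zero hn0, hm m n hmn]
    push_cast
    rw [Complex.natCast_mul_natCast_cpow]
    ring
  have hr : ∀ p : ℕ, p.Prime → 0 ≤ (p : ℝ) ^ (-σ) ∧ (p : ℝ) ^ (-σ) ≤ (2 : ℝ) ^ (-σ) ∧
      (p : ℝ) ^ (-σ) < 1 := by
    intro p hp
    have h2 : (2 : ℝ) ≤ p := by exact_mod_cast hp.two_le
    refine ⟨by positivity, ?_, ?_⟩
    · exact Real.rpow_le_rpow_of_nonpos (by norm_num) h2 (by linarith)
    · exact Real.rpow_lt_one_of_one_lt_of_neg (by linarith) (by linarith)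
  have hgb : ∀ p k : ℕ, p.Prime → g (p ^ k) ≤ ((k : ℝ) + 1) ^ A * ((p : ℝ) ^ (-σ)) ^ k := by
    intro p k hp
    rw [hgpow p k hp]
    exact mul_le_mul_of_nonneg_right (hb p k hp) (pow_nonneg (hr p hp).1 _)
  have hg0 : ∀ n, 0 ≤ g n := fun n => norm_nonneg _
  have hsumloc : ∀ {p : ℕ}, p.Prime → Summable (fun k : ℕ => ‖g (p ^ k)‖) := by
    intro p hp
    refine Summable.of_nonneg_of_le (fun _ => norm_nonneg _) (fun k => ?_)
      (aux_local_summable A 1 (hr p hp).1 (hr p hp).2.2)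
    rw [Real.norm_of_nonneg (hg0 _)]
    simpa using hgb p k hp
  have hsumloc' : ∀ {p : ℕ}, p.Prime → Summable (fun k : ℕ => g (p ^ k)) := by
    intro p hp
    exact (hsumloc hp).of_norm
  set t : ℕ → ℝ := fun p => if p.Prime then ∑' k : ℕ, g (p ^ (k + 1)) else 0 with ht
  have ht0 : ∀ p, 0 ≤ t p := by
    intro p
    simp only [ht]
    split_ifs
    · exact tsum_nonneg fun _ => hg0 _
    · exact le_rfl
  set C : ℝ := ∑' k : ℕ, ((k : ℝ) + (j + 1 : ℕ)) ^ A * ((2 : ℝ) ^ (-σ)) ^ k with hC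
  have h2sum := aux_local_summable A (j + 1) (hr 2 Nat.prime_two).1 (hr 2 Nat.prime_two).2.2
  have htb : ∀ p, N ≤ p → t p ≤ C * (p : ℝ) ^ (-(j * σ)) := by
    intro p hNp
    simp only [ht]
    split_ifs with hp
    · obtain ⟨i, rfl⟩ : ∃ i, j = i + 1 := ⟨j - 1, by omega⟩
      have hs1 : Summable (fun k : ℕ => g (p ^ (k + 1))) := 
        (summable_nat_add_iff (f := fun k : ℕ => g (p ^ k)) 1).2 (hsumloc' hp)
      rw [← hs1.sum_add_tsum_nat_add i]
      rw [Finset.sum_eq_zero, zero_add]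
      · rw [hC, mul_comm, ← tsum_mul_left]
        refine Summable.tsum_le_tsum (fun k => ?_) 
          ((summable_nat_add_iff (f := fun k : ℕ => g (p ^ (k + 1))) i).2 hs1)
          (by simpa using h2sum.mul_left _)
        refine (hgb p _ hp).trans ?_
        have e1 : ((p : ℝ) ^ (-σ)) ^ (k + i + 1) =
            (p : ℝ) ^ (-(((i + 1 : ℕ) : ℝ) * σ)) * ((p : ℝ) ^ (-σ)) ^ k := by
          rw [add_assoc, pow_add, mul_comm]
          congr 1
          rw [← Real.rpow_natCast, ← Real.rpow_mul (by positivity)]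
          congr 1
          ring
        rw [e1, mul_left_comm]
        have e2 : ((k + i + 1 : ℕ) : ℝ) + 1 = (k : ℝ) + ((i + 1 + 1 : ℕ) : ℝ) := by
          push_cast; ring
        rw [e2]
        have := (hr p hp).2.1
        have := (hr p hp).1
        gcongr
      · intro k hk
        rw [Finset.mem_range] at hk
        rw [hgpow p _ hp, hv p (k + 1) hp hNp (by omega) (by omega)]
        simp
    · exact mul_nonneg (tsum_nonneg fun _ => by positivity) (by positivity)
  have htsum : Summable t := by
    rw [← summable_nat_add_iff N]
    have hz : Summable (fun n : ℕ => (n : ℝ) ^ (-(j * σ))) :=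
      Real.summable_nat_rpow.2 (by linarith)
    refine Summable.of_nonneg_of_le (fun _ => ht0 _) (fun p => htb (p + N) (by omega)) ?_
    exact ((summable_nat_add_iff (f := fun n : ℕ => (n : ℝ) ^ (-(j * σ))) N).2 hz).mul_left C
  have hfin : Summable g := by
    refine summable_of_sum_range_le (c := Real.exp (∑' p, t p)) hg0 fun M => ?_
    obtain ⟨hS, hH⟩ := EulerProduct.summable_and_hasSum_smoothNumbers_prod_primesBelow_tsum
      hg1 hgm hsumloc M
    have hprod : ∏ p ∈ M.primesBelow, ∑' n : ℕ, g (p ^ n) ≤ Real.exp (∑' p, t p) := by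
      calc ∏ p ∈ M.primesBelow, ∑' n : ℕ, g (p ^ n)
          ≤ ∏ p ∈ M.primesBelow, Real.exp (t p) := by
            refine Finset.prod_le_prod (fun p _ => tsum_nonneg fun _ => hg0 _) fun p hp => ?_
            have hp' := Nat.prime_of_mem_primesBelow hp
            rw [(hsumloc' hp').tsum_eq_zero_add]
            simp only [pow_zero, hg1, ht, hp', if_true]
            rw [add_comm]
            exact Real.add_one_le_exp _
        _ = Real.exp (∑ p ∈ M.primesBelow, t p) := (Real.exp_sum _ _).symm
        _ ≤ _ := by
            apply Real.exp_le_exp.2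
            exact htsum.sum_le_tsum _ fun p _ => ht0 p
    refine le_trans ?_ hprod
    rw [← hH.tsum_eq]
    have hsub : ∑ i ∈ Finset.range M, g i = ∑ i ∈ (Finset.range M).filter (· ∈ M.smoothNumbers), g i := by
      rw [Finset.sum_filter]
      refine Finset.sum_congr rfl fun i hi => ?_
      rw [Finset.mem_range] at hi
      by_cases hi0 : i = 0
      · subst hi0; simp [hg]
      · rw [if_pos (Nat.mem_smoothNumbers_of_lt (Nat.pos_of_ne_zero hi0) hi)]
    rw [hsub, ← Finset.sum_subtype_of_mem (p := (· ∈ M.smoothNumbers)) g (by simp)]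
    exact hH.summable.sum_le_tsum _ fun _ _ => hg0 _
  exact hfin.of_norm

section ideals
variable (K : Type) [Field K] [NumberField K]

lemma aux_coprime {I J : Ideal (𝓞 K)} (h : Nat.Coprime I.absNorm J.absNorm) : IsCoprime I J := by
  rw [Ideal.isCoprime_iff_exists]
  have hz : IsCoprime (I.absNorm : ℤ) (J.absNorm : ℤ) := Nat.isCoprime_iff_coprime.2 h
  obtain ⟨a, b, hab⟩ := hz
  refine ⟨(a : 𝓞 K) * (I.absNorm : 𝓞 K), I.mul_mem_left _ (Ideal.absNorm_mem I),
    (b : 𝓞 K) * (J.absNorm : 𝓞 K), J.mul_mem_left _ (Ideal.absNorm_mem J), ?_⟩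
  exact_mod_cast congrArg (fun z : ℤ => (z : 𝓞 K)) hab

lemma aux_norm_dvd {n m : ℕ} (hmn : Nat.Coprime m n) (L : Ideal (𝓞 K)) (hL : L.absNorm = m * n) :
    (L ⊔ Ideal.span {(m : 𝓞 K)}).absNorm ∣ m := by
  have h1 : (L ⊔ Ideal.span {(m : 𝓞 K)}).absNorm ∣ m * n := by
    rw [← hL]; exact Ideal.absNorm_dvd_absNorm_of_le le_sup_left
  have h2 : (L ⊔ Ideal.span {(m : 𝓞 K)}).absNorm ∣ (Ideal.span {(m : 𝓞 K)}).absNorm :=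
    Ideal.absNorm_dvd_absNorm_of_le le_sup_right
  have h3 : (Ideal.span {(m : 𝓞 K)}).absNorm = m ^ Module.finrank ℤ (𝓞 K) := by
    rw [Ideal.absNorm_span_singleton]
    have := Algebra.norm_algebraMap (R := ℤ) (S := 𝓞 K) (m : ℤ)
    simp at this
    simp [this, Int.natAbs_pow]
  rw [h3] at h2
  refine Nat.Coprime.dvd_of_dvd_mul_right ?_ h1
  exact Nat.Coprime.coprime_dvd_left h2 (hmn.pow_left _)

lemma aK_mul {m n : ℕ} (hm : m ≠ 0) (hn : n ≠ 0) (hmn : Nat.Coprime m n) :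
    aK K (m * n) = aK K m * aK K n := by
  unfold aK
  rw [← Nat.card_prod]
  symm
  refine Nat.card_eq_of_bijective (fun x => ⟨x.1.1 * x.2.1, mul_ne_zero x.1.2.1 x.2.2.1, by
    rw [map_mul, x.1.2.2, x.2.2.2]⟩) ⟨?_, ?_⟩
  · rintro ⟨⟨I, hI0, hI⟩, ⟨J, hJ0, hJ⟩⟩ ⟨⟨I', hI0', hI'⟩, ⟨J', hJ0', hJ'⟩⟩ h
    simp only [Subtype.mk.injEq] at h
    have c1 : IsCoprime I J' := aux_coprime K (by rw [hI, hJ']; exact hmn)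
    have c2 : IsCoprime I' J := aux_coprime K (by rw [hI', hJ]; exact hmn)
    have d1 : I ∣ I' := c1.dvd_of_dvd_mul_right (h ▸ dvd_mul_right I J)
    have d2 : I' ∣ I := c2.dvd_of_dvd_mul_right (h ▸ dvd_mul_right I' J')
    have e : I = I' := le_antisymm (Ideal.le_of_dvd d2) (Ideal.le_of_dvd d1)
    subst e
    have e2 : J = J' := mul_left_cancel₀ (show I ≠ 0 from hI0) h
    subst e2
    rfl
  · rintro ⟨L, hL0, hL⟩
    set I := L ⊔ Ideal.span {(m : 𝓞 K)} with hI
    set J := L ⊔ Ideal.span {(n : 𝓞 K)} with hJ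
    have hprod : I * J = L := by
      apply le_antisymm
      · rw [hI, hJ, Ideal.sup_mul, Ideal.mul_sup, Ideal.mul_sup]
        refine sup_le (sup_le Ideal.mul_le_left Ideal.mul_le_left) (sup_le Ideal.mul_le_right ?_)
        rw [Ideal.span_singleton_mul_span_singleton, Ideal.span_singleton_le_iff_mem]
        have := Ideal.absNorm_mem L
        rw [hL] at this
        exact_mod_cast this
      · intro x hx
        have hz : IsCoprime (m : ℤ) (n : ℤ) := Nat.isCoprime_iff_coprime.2 hmn
        obtain ⟨a, b, hab⟩ := hz
        have hab' : (a : 𝓞 K) * (m : 𝓞 K) + (b : 𝓞 K) * (n : 𝓞 K) = 1 := by exact_mod_cast congrArg (fun z : ℤ => (z : 𝓞 K)) hab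
        have : x = (a * m) * x + x * (b * n) := by
          rw [mul_comm x, ← add_mul, hab', one_mul]
        rw [this]
        refine Ideal.add_mem _ (Ideal.mul_mem_mul ?_ ?_) (Ideal.mul_mem_mul ?_ ?_)
        · exact Ideal.mem_sup_right (Ideal.mem_span_singleton.2 (dvd_mul_left _ _))
        · exact Ideal.mem_sup_left hx
        · exact Ideal.mem_sup_left hx
        · exact Ideal.mem_sup_right (Ideal.mem_span_singleton.2 (dvd_mul_left _ _))
    have nI : I.absNorm ∣ m := aux_norm_dvd K hmn L hL
    have nJ : J.absNorm ∣ n := aux_norm_dvd K hmn.symm L (by rw [hL, mul_comm])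
    have nIJ : I.absNorm * J.absNorm = m * n := by rw [← map_mul, hprod, hL]
    obtain ⟨a, ha⟩ := nI
    obtain ⟨b, hb⟩ := nJ
    have hab : a * b = 1 := by
      have h0 : 0 < I.absNorm * J.absNorm := by rw [nIJ]; positivity
      have : I.absNorm * J.absNorm * (a * b) = I.absNorm * J.absNorm * 1 := by
        rw [mul_one]
        conv_rhs => rw [nIJ]
        rw [ha, hb] ; ring
      exact Nat.eq_of_mul_eq_mul_left h0 this
    have ha1 : a = 1 := Nat.eq_one_of_mul_eq_one_right hab
    have hb1 : b = 1 := Nat.eq_one_of_mul_eq_one_left hab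
    have hI0 : I ≠ ⊥ := fun h => hL0 (by rw [← hprod, h, Ideal.bot_mul])
    have hJ0 : J ≠ ⊥ := fun h => hL0 (by rw [← hprod, h, Ideal.mul_bot])
    refine ⟨⟨⟨I, hI0, by rw [ha, ha1, mul_one]⟩, ⟨J, hJ0, by rw [hb, hb1, mul_one]⟩⟩, ?_⟩
    simp [hprod]

lemma aK_one : aK K 1 = 1 := by
  unfold aK
  rw [Nat.card_eq_one_iff_unique]
  refine ⟨⟨fun a b => ?_⟩, ⟨⟨⊤, top_ne_bot, by simp⟩⟩⟩
  ext1
  rw [Ideal.absNorm_eq_one_iff.1 a.2.2, Ideal.absNorm_eq_one_iff.1 b.2.2]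

lemma aK_zero : aK K 0 = 0 := by
  unfold aK
  have : IsEmpty {I : Ideal (𝓞 K) // I ≠ ⊥ ∧ I.absNorm = 0} :=
    ⟨fun I => I.2.1 (Ideal.absNorm_eq_zero_iff.1 I.2.2)⟩
  simp

end ideals

section localfactor
variable (K : Type) [Field K] [NumberField K]

/-- The finite set of primes above `p`. -/
noncomputable def auxS (p : ℕ) : Finset (Ideal (𝓞 K)) :=
  IsDedekindDomain.primesOverFinset (Ideal.span {(p : ℤ)}) (𝓞 K)

/-- residue degree. -/
noncomputable def auxf (p : ℕ) (P : Ideal (𝓞 K)) : ℕ := (Ideal.span {(p : ℤ)}).inertiaDeg' P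

variable {K}

lemma auxS_mem {p : ℕ} (hp : p.Prime) {P : Ideal (𝓞 K)} :
    P ∈ auxS K p ↔ P.IsPrime ∧ P.LiesOver (Ideal.span {(p : ℤ)}) := by
  have : Fact p.Prime := ⟨hp⟩
  unfold auxS
  rw [IsDedekindDomain.mem_primesOverFinset_iff (by simpa using hp.ne_zero)]
  rfl

lemma auxS_mem_of_mem {p : ℕ} (hp : p.Prime) {P : Ideal (𝓞 K)} (hP : P.IsPrime)
    (h : (p : 𝓞 K) ∈ P) : P ∈ auxS K p := by
  rw [auxS_mem hp]
  refine ⟨hP, ⟨?_⟩⟩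
  have : Fact p.Prime := ⟨hp⟩
  have hmax : (Ideal.span {(p : ℤ)}).IsMaximal := inferInstance
  refine hmax.eq_of_le ?_ ?_
  · exact (Ideal.IsPrime.under ℤ P).ne_top
  · rw [Ideal.span_singleton_le_iff_mem, Ideal.under_def, Ideal.mem_comap]
    simpa using h

lemma auxS_norm {p : ℕ} (hp : p.Prime) {P : Ideal (𝓞 K)} (h : P ∈ auxS K p) :
    P.absNorm = p ^ auxf K p P := by
  have := ((auxS_mem hp).1 h).2
  exact Ideal.absNorm_eq_pow_inertiaDeg' P hp

lemma auxS_f_pos {p : ℕ} (hp : p.Prime) {P : Ideal (𝓞 K)} (h : P ∈ auxS K p) :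
    0 < auxf K p P := by
  rcases Nat.eq_zero_or_pos (auxf K p P) with h0 | h0
  · exfalso
    have h1 := auxS_norm hp h
    rw [h0, pow_zero, Ideal.absNorm_eq_one_iff] at h1
    exact ((auxS_mem hp).1 h).1.ne_top h1
  · exact h0

lemma auxS_prime {p : ℕ} (hp : p.Prime) {P : Ideal (𝓞 K)} (h : P ∈ auxS K p) : Prime P := by
  have h1 := auxS_norm hp h
  refine Ideal.prime_of_isPrime ?_ ((auxS_mem hp).1 h).1
  rintro rfl
  simp at h1
  exact pow_ne_zero _ hp.ne_zero h1.symm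

lemma aux_mem_S_of_dvd {p k : ℕ} (hp : p.Prime) {I Q : Ideal (𝓞 K)} (hI : I.absNorm = p ^ k)
    (hQ : Prime Q) (h : Q ∣ I) : Q ∈ auxS K p := by
  have hQ' : Q.IsPrime := Ideal.isPrime_of_prime hQ
  refine auxS_mem_of_mem hp hQ' ?_
  have h1 := Ideal.le_of_dvd h (Ideal.absNorm_mem I)
  rw [hI] at h1
  push_cast at h1
  exact hQ'.mem_of_pow_mem _ h1

open Classical in
lemma aux_local (p : ℕ) (hp : p.Prime) :
    PowerSeries.mk (fun k => (aK K (p ^ k) : ℂ)) =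
      ∏ P ∈ auxS K p, PowerSeries.mk (fun k => if auxf K p P ∣ k then (1 : ℂ) else 0) := by
  ext k
  rw [PowerSeries.coeff_prod, PowerSeries.coeff_mk]
  simp only [PowerSeries.coeff_mk, Finset.prod_boole]
  rw [Finset.sum_boole]
  congr 1
  unfold aK
  rw [← Nat.card_eq_finsetCard]
  symm
  set S := auxS K p with hS
  set f := auxf K p with hf
  have hnorm : ∀ e : Ideal (𝓞 K) → ℕ,
      (∏ P ∈ S, P ^ e P).absNorm = p ^ (∑ P ∈ S, f P * e P) := by
    intro e
    rw [map_prod, ← Finset.prod_pow_eq_pow_sum]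
    refine Finset.prod_congr rfl fun P hP => ?_
    rw [map_pow, auxS_norm hp hP, pow_mul]
  refine Nat.card_eq_of_bijective (fun l => ⟨∏ P ∈ S, P ^ (l.1 P / f P), ?_, ?_⟩) ⟨?_, ?_⟩
  · exact Finset.prod_ne_zero_iff.2 fun P hP => pow_ne_zero _ (auxS_prime hp hP).ne_zero
  · obtain ⟨l, hl⟩ := l
    rw [Finset.mem_filter, Finset.mem_finsuppAntidiag] at hl
    rw [hnorm]
    congr 1
    refine Eq.trans (Finset.sum_congr rfl fun P hP => ?_) hl.1.1
    exact Nat.mul_div_cancel' (hl.2 P hP)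
  · rintro ⟨l, hl⟩ ⟨l', hl'⟩ h
    rw [Finset.mem_filter, Finset.mem_finsuppAntidiag] at hl hl'
    simp only [Subtype.mk.injEq] at h ⊢
    have key : ∀ e : Ideal (𝓞 K) → ℕ, ∀ P ∈ S,
        (UniqueFactorizationMonoid.normalizedFactors (∏ P ∈ S, P ^ e P)).count P = e P := by
      intro e P hP
      have e1 : ∏ P ∈ S, P ^ e P = (∑ P ∈ S, Multiset.replicate (e P) P).prod := by
        rw [Multiset.prod_sum]
        simp
      rw [e1, UniqueFactorizationMonoid.normalizedFactors_prod_of_prime, Multiset.count_sum']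
      · simp only [Multiset.count_replicate]
        rw [Finset.sum_ite_eq' S P e, if_pos hP]
      · intro Q hQ
        rw [Multiset.mem_sum] at hQ
        obtain ⟨R, hR, hQR⟩ := hQ
        rw [Multiset.eq_of_mem_replicate hQR]
        exact auxS_prime hp hR
    ext P
    by_cases hP : P ∈ S
    · have h1 := key (fun P => l P / f P) P hP
      have h2 := key (fun P => l' P / f P) P hP
      rw [h, h2] at h1
      have h3 := Nat.mul_div_cancel' (hl.2 P hP)
      have h4 := Nat.mul_div_cancel' (hl'.2 P hP)
      rw [← h3, ← h4]
      rw [h1]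
    · rw [Finsupp.notMem_support_iff.1 fun h => hP (hl.1.2 h),
        Finsupp.notMem_support_iff.1 fun h => hP (hl'.1.2 h)]
  · rintro ⟨I, hI0, hI⟩
    set m := UniqueFactorizationMonoid.normalizedFactors I with hm
    have hsub : m.toFinset ⊆ S := by
      intro Q hQ
      rw [Multiset.mem_toFinset] at hQ
      exact aux_mem_S_of_dvd hp hI (UniqueFactorizationMonoid.prime_of_normalized_factor Q hQ)
        (UniqueFactorizationMonoid.dvd_of_mem_normalizedFactors hQ)
    have hprod : ∏ P ∈ S, P ^ m.count P = I := by
      rw [← Finset.prod_multiset_count_of_subset m S hsub]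
      exact Ideal.prod_normalizedFactors_eq_self hI0
    have hsum : ∑ P ∈ S, f P * m.count P = k := by
      have := hnorm (fun P => m.count P)
      rw [hprod, hI] at this
      exact (Nat.pow_right_injective hp.two_le this).symm
    refine ⟨⟨Finsupp.indicator S (fun P _ => f P * m.count P), ?_⟩, ?_⟩
    · rw [Finset.mem_filter, Finset.mem_finsuppAntidiag]
      refine ⟨⟨?_, Finsupp.support_indicator_subset _ _⟩, ?_⟩
      · rw [← hsum]
        exact Finset.sum_congr rfl fun P hP => Finsupp.indicator_of_mem hP _
      · intro P hP
        rw [Finsupp.indicator_of_mem hP]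
        exact dvd_mul_right _ _
    · simp only [Subtype.mk.injEq]
      refine Eq.trans (Finset.prod_congr rfl fun P hP => ?_) hprod
      rw [Finsupp.indicator_of_mem hP, Nat.mul_div_cancel_left _ (auxS_f_pos hp hP)]

lemma auxS_card {p : ℕ} (hp : p.Prime) : (auxS K p).card ≤ Module.finrank ℚ K := by
  have : Fact p.Prime := ⟨hp⟩
  exact Ideal.card_primesOverFinset_le_finrank (𝓞 K) ℚ K (by simpa using hp.ne_zero)

end localfactor

section series

/-- polynomial growth of coefficients -/
def auxBdd (a : PowerSeries ℂ) (A : ℕ) : Prop :=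
  ∀ k : ℕ, ‖PowerSeries.coeff k a‖ ≤ ((k : ℝ) + 1) ^ A

lemma auxBdd.mono {a : PowerSeries ℂ} {A B : ℕ} (h : auxBdd a A) (hAB : A ≤ B) : auxBdd a B := by
  intro k
  refine (h k).trans (pow_le_pow_right₀ ?_ hAB)
  have : (0 : ℝ) ≤ k := by positivity
  linarith

lemma auxBdd.mul {a b : PowerSeries ℂ} {A B : ℕ} (ha : auxBdd a A) (hb : auxBdd b B) :
    auxBdd (a * b) (A + B + 1) := by
  intro k
  rw [PowerSeries.coeff_mul]
  calc ‖∑ x ∈ Finset.HasAntidiagonal.antidiagonal k, PowerSeries.coeff x.1 a * PowerSeries.coeff x.2 b‖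
      ≤ ∑ x ∈ Finset.HasAntidiagonal.antidiagonal k, ((k : ℝ) + 1) ^ A * ((k : ℝ) + 1) ^ B := by
        refine norm_sum_le_of_le _ fun x hx => ?_
        rw [Finset.HasAntidiagonal.mem_antidiagonal] at hx
        rw [norm_mul]
        have h1 : (x.1 : ℝ) ≤ k := by exact_mod_cast (by omega : x.1 ≤ k)
        have h2 : (x.2 : ℝ) ≤ k := by exact_mod_cast (by omega : x.2 ≤ k)
        have h3 := ha x.1
        have h4 := hb x.2
        have h5 : ((x.1 : ℝ) + 1) ^ A ≤ ((k : ℝ) + 1) ^ A := by gcongr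
        have h6 : ((x.2 : ℝ) + 1) ^ B ≤ ((k : ℝ) + 1) ^ B := by gcongr
        exact mul_le_mul (h3.trans h5) (h4.trans h6) (norm_nonneg _) (by positivity)
    _ = _ := by
        rw [Finset.sum_const, Finset.Nat.card_antidiagonal, nsmul_eq_mul]
        push_cast
        ring

lemma auxBdd_one : auxBdd 1 0 := by
  intro k
  rw [PowerSeries.coeff_one]
  split_ifs <;> simp

lemma auxBdd_prod {ι : Type*} (S : Finset ι) (a : ι → PowerSeries ℂ)
    (h : ∀ i ∈ S, auxBdd (a i) 0) : auxBdd (∏ i ∈ S, a i) S.card := by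
  classical
  induction S using Finset.induction_on with
  | empty => simpa using auxBdd_one
  | insert i S hi ih =>
    rw [Finset.prod_insert hi, Finset.card_insert_of_notMem hi]
    have h1 := (h i (Finset.mem_insert_self i S)).mul
      (ih fun j hj => h j (Finset.mem_insert_of_mem hj))
    exact h1.mono (by omega)

lemma auxBdd.pow {a : PowerSeries ℂ} {A : ℕ} (h : auxBdd a A) (m : ℕ) :
    auxBdd (a ^ m) (m * (A + 1)) := by
  induction m with
  | zero => simpa using auxBdd_one
  | succ m ih =>
    rw [pow_succ]
    exact (ih.mul h).mono (by ring_nf; omega)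

lemma aux_geom_bdd (f : ℕ) : auxBdd (PowerSeries.mk (fun k => if f ∣ k then (1 : ℂ) else 0)) 0 := by
  intro k
  rw [PowerSeries.coeff_mk]
  split_ifs <;> simp

lemma aux_inv_bdd (f : ℕ) (hf : 0 < f) : auxBdd (1 - PowerSeries.X ^ f : PowerSeries ℂ) 0 := by
  intro k
  rw [map_sub, PowerSeries.coeff_one, PowerSeries.coeff_X_pow]
  split_ifs <;> first | omega | simp

lemma aux_geom_inv (f : ℕ) (hf : 0 < f) :
    PowerSeries.mk (fun k => if f ∣ k then (1 : ℂ) else 0) * (1 - PowerSeries.X ^ f) = 1 := by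
  ext k
  rw [mul_sub, mul_one, map_sub, PowerSeries.coeff_mul_X_pow', PowerSeries.coeff_mk,
    PowerSeries.coeff_one]
  split_ifs with h1 h2 h3 h4 h5 <;> simp_all
  · exact absurd (Nat.le_of_dvd (Nat.pos_of_ne_zero ‹_›) h1) (by omega)
  · exact lt_of_le_of_ne ‹_› (by rintro rfl; exact h1 dvd_rfl)

variable (K : Type) [Field K] [NumberField K]

/-- inverse local factor -/
noncomputable def auxQ (p : ℕ) : PowerSeries ℂ :=
  ∏ P ∈ auxS K p, (1 - PowerSeries.X ^ auxf K p P)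

lemma auxQ_mul (p : ℕ) (hp : p.Prime) :
    PowerSeries.mk (fun k => (aK K (p ^ k) : ℂ)) * auxQ K p = 1 := by
  rw [aux_local p hp, auxQ, ← Finset.prod_mul_distrib]
  exact Finset.prod_eq_one fun P hP => aux_geom_inv _ (auxS_f_pos hp hP)

lemma auxQ_bdd (p : ℕ) (hp : p.Prime) : auxBdd (auxQ K p) (Module.finrank ℚ K) :=
  (auxBdd_prod _ _ fun P hP => aux_inv_bdd _ (auxS_f_pos hp hP)).mono (auxS_card hp)

lemma aux_local_bdd (p : ℕ) (hp : p.Prime) :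
    auxBdd (PowerSeries.mk (fun k => (aK K (p ^ k) : ℂ))) (Module.finrank ℚ K) := by
  rw [aux_local p hp]
  exact (auxBdd_prod _ _ fun _ _ => aux_geom_bdd _).mono (auxS_card hp)

end series

section arith

/-- local series of an arithmetic function -/
noncomputable def auxLoc (g : ArithmeticFunction ℂ) (p : ℕ) : PowerSeries ℂ :=
  PowerSeries.mk fun k => g (p ^ k)

lemma auxLoc_mul (f g : ArithmeticFunction ℂ) {p : ℕ} (hp : p.Prime) :
    auxLoc (f * g) p = auxLoc f p * auxLoc g p := by
  ext k
  unfold auxLoc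
  rw [PowerSeries.coeff_mul, PowerSeries.coeff_mk, ArithmeticFunction.mul_apply,
    Nat.sum_divisorsAntidiagonal (fun i j => f i * g j), Nat.sum_divisors_prime_pow hp]
  simp only [PowerSeries.coeff_mk]
  rw [Finset.Nat.sum_antidiagonal_eq_sum_range_succ (fun i j => f (p ^ i) * g (p ^ j))]
  refine Finset.sum_congr rfl fun i hi => ?_
  rw [Nat.pow_div (by simp at hi; omega) hp.pos]

lemma auxLoc_one {p : ℕ} (hp : p.Prime) : auxLoc 1 p = 1 := by
  ext k
  unfold auxLoc
  rw [PowerSeries.coeff_mk, PowerSeries.coeff_one, ArithmeticFunction.one_apply]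
  simp [hp.ne_one]

lemma auxLoc_pow (f : ArithmeticFunction ℂ) {p : ℕ} (hp : p.Prime) (m : ℕ) :
    auxLoc (f ^ m) p = auxLoc f p ^ m := by
  induction m with
  | zero => simpa using auxLoc_one hp
  | succ m ih => rw [pow_succ, pow_succ, auxLoc_mul _ _ hp, ih]

lemma aux_conv_prime (f g : ArithmeticFunction ℂ) {p : ℕ} (hp : p.Prime) :
    (f * g) p = f p * g 1 + f 1 * g p := by
  rw [ArithmeticFunction.mul_apply, Nat.sum_divisorsAntidiagonal (fun i j => f i * g j),
    hp.sum_divisors, Nat.div_self hp.pos, Nat.div_one]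

/-- multiplicative function with given local series -/
noncomputable def auxU (L : ℕ → PowerSeries ℂ) : ArithmeticFunction ℂ :=
  ⟨fun n => if n = 0 then 0 else n.factorization.prod fun p k => PowerSeries.coeff k (L p), by simp⟩

lemma auxU_apply (L : ℕ → PowerSeries ℂ) {n : ℕ} (hn : n ≠ 0) :
    auxU L n = n.factorization.prod fun p k => PowerSeries.coeff k (L p) := by
  change (if n = 0 then _ else _) = _
  rw [if_neg hn]

lemma auxU_mult (L : ℕ → PowerSeries ℂ) : (auxU L).IsMultiplicative := by
  rw [ArithmeticFunction.IsMultiplicative.iff_ne_zero]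
  refine ⟨by rw [auxU_apply L one_ne_zero]; simp, fun {m n} hm hn hmn => ?_⟩
  rw [auxU_apply L hm, auxU_apply L hn, auxU_apply L (mul_ne_zero hm hn),
    Nat.factorization_mul hm hn, Finsupp.prod_add_index_of_disjoint]
  simpa using hmn.disjoint_primeFactors

lemma auxU_pow (L : ℕ → PowerSeries ℂ) {p : ℕ} (hp : p.Prime)
    (h1 : PowerSeries.coeff 0 (L p) = 1) (k : ℕ) :
    auxU L (p ^ k) = PowerSeries.coeff k (L p) := by
  rw [auxU_apply L (pow_ne_zero _ hp.ne_zero), hp.factorization_pow, Finsupp.prod_single_index h1]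

/-- ideal counting as arithmetic function -/
noncomputable def auxG (K : Type) [Field K] [NumberField K] : ArithmeticFunction ℂ :=
  ⟨fun n => (aK K n : ℂ), by simp [aK_zero]⟩

lemma auxG_mult (K : Type) [Field K] [NumberField K] : (auxG K).IsMultiplicative := by
  rw [ArithmeticFunction.IsMultiplicative.iff_ne_zero]
  refine ⟨by simp [auxG, aK_one], fun {m n} hm hn hmn => ?_⟩
  simp [auxG, aK_mul K hm hn hmn]

lemma auxG_sum (K : Type) [Field K] [NumberField K] (s : ℂ) (hs : 1 < s.re) :
    LSeriesSummable (auxG K) s := by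
  refine aux_analytic (auxG K) (auxG_mult K).1 (fun m n h => (auxG_mult K).2 h)
    (Module.finrank ℚ K) 1 0 le_rfl (fun p k hp => ?_) (fun p k _ _ _ _ => by omega) s (by simpa)
  have := aux_local_bdd K p hp k
  rwa [PowerSeries.coeff_mk] at this

lemma aux_pow_sum (f : ArithmeticFunction ℂ) (s : ℂ) (h : LSeriesSummable f s) (m : ℕ) :
    LSeriesSummable ⇑(f ^ m) s ∧ LSeries ⇑(f ^ m) s = LSeries f s ^ m := by
  induction m with
  | zero =>
    rw [pow_zero, pow_zero]
    have e : ⇑(1 : ArithmeticFunction ℂ) = LSeries.delta := ArithmeticFunction.one_eq_delta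
    rw [e]
    refine ⟨?_, by rw [LSeries_delta]; rfl⟩
    refine (LSeriesSummable_congr (f := fun n => if n = 1 then (1:ℂ) else 0) s ?_).1 ?_
    · intro n hn; simp [LSeries.delta]
    · refine summable_of_ne_finset_zero (s := {1}) fun n hn => ?_
      simp at hn
      simp [LSeries.term, hn]
  | succ m ih =>
    rw [pow_succ, pow_succ, ← ih.2]
    exact ⟨ArithmeticFunction.LSeriesSummable_mul ih.1 h, ArithmeticFunction.LSeries_mul' ih.1 h⟩

theorem aux_main (K K₁ K₂ : Type) [Field K] [NumberField K] [Field K₁] [NumberField K₁]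
    [Field K₂] [NumberField K₂] (l m N : ℕ)
    (h : ∀ p : ℕ, p.Prime → N ≤ p → aK K₁ p ^ l * aK K₂ p ^ l = m * aK K p) (hl : 1 ≤ l) :
    ∃ u : ℕ → ℂ,
      (∀ s : ℂ, 1 / 2 < s.re → LSeriesSummable u s) ∧
      ∀ s : ℂ, 1 < s.re →
        LSeries (fun n => (aK K₁ n : ℂ) ^ l * (aK K₂ n : ℂ) ^ l) s
          = dzeta K s ^ m * LSeries u s := by
  set f : ArithmeticFunction ℂ :=
    ⟨fun n => (aK K₁ n : ℂ) ^ l * (aK K₂ n : ℂ) ^ l, by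
      have hl0 : l ≠ 0 := by omega
      simp [aK_zero, hl0]⟩ with hf
  have hfa : ∀ n, f n = (aK K₁ n : ℂ) ^ l * (aK K₂ n : ℂ) ^ l := fun _ => rfl
  have hfm : f.IsMultiplicative := by
    rw [ArithmeticFunction.IsMultiplicative.iff_ne_zero]
    refine ⟨by simp [hfa, aK_one], fun {m n} hm hn hmn => ?_⟩
    rw [hfa, hfa, hfa, aK_mul K₁ hm hn hmn, aK_mul K₂ hm hn hmn]
    push_cast
    ring
  set L : ℕ → PowerSeries ℂ := fun p => auxLoc f p * auxQ K p ^ m with hL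
  have hG : ∀ p, p.Prime → auxLoc (auxG K) p * auxQ K p = 1 := fun p hp => auxQ_mul K p hp
  have hconst : ∀ (g : ArithmeticFunction ℂ) p, g.IsMultiplicative →
      PowerSeries.coeff 0 (auxLoc g p) = 1 := by
    intro g p hg
    simp [auxLoc, hg.1]
  have hL0 : ∀ p, p.Prime → PowerSeries.coeff 0 (L p) = 1 := by
    intro p hp
    have h1 := hconst f p hfm
    have h2 := hconst (auxG K) p (auxG_mult K)
    have h3 := congrArg (PowerSeries.coeff 0) (hG p hp)
    simp only [PowerSeries.coeff_zero_eq_constantCoeff, map_mul, map_one] at h1 h2 h3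
    rw [h2, one_mul] at h3
    simp [hL, h1, h3]
  have hu : auxG K ^ m * auxU L = f := by
    rw [ArithmeticFunction.IsMultiplicative.eq_iff_eq_on_prime_powers _
      ((auxG_mult K).pow.mul (auxU_mult L)) _ hfm]
    intro p i hp
    have h1 : auxLoc (auxU L) p = L p := by
      ext k
      rw [auxLoc, PowerSeries.coeff_mk, auxU_pow L hp (hL0 p hp)]
    have h2 : auxLoc (auxG K ^ m * auxU L) p = auxLoc f p := by
      rw [auxLoc_mul _ _ hp, auxLoc_pow _ hp, h1, hL]
      calc _ = auxLoc f p * (auxLoc (auxG K) p * auxQ K p) ^ m := by ring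
        _ = _ := by rw [hG p hp]; simp
    have h3 := congrArg (PowerSeries.coeff i) h2
    simpa [auxLoc] using h3
  have hvan : ∀ p, p.Prime → N ≤ p → auxU L p = 0 := by
    intro p hp hNp
    have h5 : ∀ m : ℕ, (auxG K ^ m) p = m * auxG K p := by
      intro m
      induction m with
      | zero => simp [hp.ne_one]
      | succ m ih =>
        rw [pow_succ, aux_conv_prime _ _ hp, ih, (auxG_mult K).pow.1, (auxG_mult K).1]
        push_cast; ring
    have h1 := aux_conv_prime (auxG K ^ m) (auxU L) hp
    rw [hu, h5, (auxG_mult K).pow.1, (auxU_mult L).1, hfa] at h1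
    have h6 : (aK K₁ p : ℂ) ^ l * (aK K₂ p : ℂ) ^ l = m * aK K p := by exact_mod_cast h p hp hNp
    rw [h6] at h1
    have h7 : auxG K p = aK K p := rfl
    rw [h7] at h1
    linear_combination -h1
  have hfb : ∀ p, p.Prime → auxBdd (auxLoc f p)
      (Module.finrank ℚ K₁ * l + Module.finrank ℚ K₂ * l) := by
    intro p hp k
    have h1 := aux_local_bdd K₁ p hp k
    have h2 := aux_local_bdd K₂ p hp k
    rw [PowerSeries.coeff_mk] at h1 h2
    rw [auxLoc, PowerSeries.coeff_mk, hfa, norm_mul, norm_pow, norm_pow, pow_add, pow_mul, pow_mul]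
    gcongr
  have hub : ∀ s : ℂ, 1 / 2 < s.re → LSeriesSummable (auxU L) s := by
    intro s hs
    refine aux_analytic (auxU L) (auxU_mult L).1 (fun m n h => (auxU_mult L).2 h)
      ((Module.finrank ℚ K₁ * l + Module.finrank ℚ K₂ * l) + m * (Module.finrank ℚ K + 1) + 1)
      2 N (by norm_num) (fun p k hp => ?_) (fun p k hp hN h1 h2 => ?_) s
      (by push_cast; linarith)
    · rw [auxU_pow L hp (hL0 p hp)]
      exact (hfb p hp).mul ((auxQ_bdd K p hp).pow m) k
    · obtain rfl : k = 1 := by omega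
      rw [pow_one]
      exact hvan p hp hN
  refine ⟨auxU L, hub, fun s hs => ?_⟩
  have h1 := aux_pow_sum (auxG K) s (auxG_sum K s hs) m
  have h2 := ArithmeticFunction.LSeries_mul' h1.1 (hub s (by linarith))
  rw [hu, h1.2] at h2
  exact h2

end arith

section galois

open scoped Pointwise

lemma aux_exists_prime (K : Type) [Field K] [NumberField K] {p : ℕ} (hp : p.Prime) :
    aK K p ≠ 0 ↔ ∃ P : Ideal (𝓞 K), P.IsPrime ∧ P.LiesOver (Ideal.span {(p : ℤ)}) ∧
      P.absNorm = p := by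
  unfold aK
  have hfin : Finite {I : Ideal (𝓞 K) // I ≠ ⊥ ∧ I.absNorm = p} :=
    Set.Finite.subset (Ideal.finite_setOfPred_absNorm_eq (S := 𝓞 K) p) (fun I hI => hI.2)
  constructor
  · intro h
    obtain ⟨⟨I, hI0, hI⟩⟩ := (Nat.card_ne_zero.1 h).1
    have hpr : I.IsPrime := Ideal.isPrime_of_irreducible_absNorm (by rw [hI]; exact hp)
    have := auxS_mem_of_mem hp hpr (by rw [← hI]; exact Ideal.absNorm_mem I)
    exact ⟨I, hpr, ((auxS_mem hp).1 this).2, hI⟩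
  · rintro ⟨P, h1, h2, h3⟩
    refine Nat.card_ne_zero.2 ⟨⟨⟨P, ?_, h3⟩⟩, hfin⟩
    rintro rfl
    simp at h3
    exact hp.ne_zero h3.symm

lemma aux_norm_iff (K : Type) [Field K] [NumberField K] {p : ℕ} (hp : p.Prime) (P : Ideal (𝓞 K))
    [P.IsPrime] [P.LiesOver (Ideal.span {(p : ℤ)})] : P.absNorm = p ↔ P.inertiaDeg ℤ = 1 := by
  rw [← Ideal.pow_inertiaDeg p P]
  constructor
  · intro h
    exact Nat.pow_right_injective hp.two_le (by simpa using h)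
  · intro h
    rw [h, pow_one]

lemma aux_ram (K : Type) [Field K] [NumberField K] {p : ℕ} (hp : p.Prime)
    (hd : ¬ (p : ℤ) ∣ NumberField.discr K) (P : Ideal (𝓞 K))
    [P.IsPrime] [P.LiesOver (Ideal.span {(p : ℤ)})] : P.ramificationIdx ℤ = 1 := by
  have : Fact p.Prime := ⟨hp⟩
  have hmax : P.IsMaximal := .of_liesOver_isMaximal _ (Ideal.span {(p : ℤ)})
  have := (NumberField.not_dvd_discr_iff_forall_liesOver K (𝓞 K)
    (Nat.prime_iff_prime_int.1 hp)).1 hd P hmax inferInstance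
  exact Ideal.ramificationIdx_eq_one_of_isUnramifiedAt

lemma aux_split (K : Type) [Field K] [NumberField K] [IsGalois ℚ K] {p : ℕ} (hp : p.Prime)
    (hd : ¬ (p : ℤ) ∣ NumberField.discr K) (h : aK K p ≠ 0) :
    (∀ P : Ideal (𝓞 K), P.IsPrime → P.LiesOver (Ideal.span {(p : ℤ)}) →
      Nat.card (MulAction.stabilizer Gal(K/ℚ) P) = 1) ∧
    aK K p = Module.finrank ℚ K := by
  have : Fact p.Prime := ⟨hp⟩
  obtain ⟨P, h1, h2, h3⟩ := (aux_exists_prime K hp).1 h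
  rw [aux_norm_iff K hp P, ← Ideal.inertiaDegIn_eq_inertiaDeg (Ideal.span {(p : ℤ)}) P Gal(K/ℚ)]
    at h3
  have hram := aux_ram K hp hd P
  rw [← Ideal.ramificationIdxIn_eq_ramificationIdx (Ideal.span {(p : ℤ)}) P Gal(K/ℚ)] at hram
  refine ⟨fun Q hQ1 hQ2 => ?_, ?_⟩
  · rw [Ideal.card_stabilizer_eq (Ideal.span {(p : ℤ)}) Q, h3, hram]
  · have hc := Ideal.ncard_primesOver_mul_ramificationIdxIn_mul_inertiaDegIn
      (Ideal.span {(p : ℤ)}) (𝓞 K) Gal(K/ℚ)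
    rw [h3, hram, mul_one, mul_one, IsGaloisGroup.card_eq_finrank Gal(K/ℚ) ℚ K] at hc
    rw [← hc, ← Nat.card_coe_set_eq]
    unfold aK
    refine Nat.card_congr (Equiv.subtypeEquivRight fun I => ?_)
    constructor
    · rintro ⟨hI0, hI⟩
      have hpr : I.IsPrime := Ideal.isPrime_of_irreducible_absNorm (by rw [hI]; exact hp)
      have := auxS_mem_of_mem hp hpr (by rw [← hI]; exact Ideal.absNorm_mem I)
      exact (auxS_mem hp).1 this
    · intro hI
      have hI1 : I.IsPrime := hI.1
      have hI2 : I.LiesOver (Ideal.span {(p : ℤ)}) := hI.2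
      have hn : I.absNorm = p := by
        rw [aux_norm_iff K hp I,
          ← Ideal.inertiaDegIn_eq_inertiaDeg (Ideal.span {(p : ℤ)}) I Gal(K/ℚ), h3]
      refine ⟨?_, hn⟩
      rintro rfl
      simp at hn
      exact hp.ne_zero hn.symm

lemma aux_down (K K₁ : Type) [Field K] [NumberField K] [Field K₁] [NumberField K₁] [Algebra K₁ K]
    {p : ℕ} (hp : p.Prime) (h : aK K p ≠ 0) : aK K₁ p ≠ 0 := by
  obtain ⟨P, h1, h2, h3⟩ := (aux_exists_prime K hp).1 h
  rw [aux_norm_iff K hp P, Ideal.inertiaDeg_tower (P.under (𝓞 K₁)) P] at h3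
  have hl : (P.under (𝓞 K₁)).LiesOver (Ideal.span {(p : ℤ)}) :=
    Ideal.LiesOver.tower_bot P _ _
  refine (aux_exists_prime K₁ hp).2 ⟨P.under (𝓞 K₁), inferInstance, hl, ?_⟩
  rw [aux_norm_iff K₁ hp]
  exact Nat.eq_one_of_mul_eq_one_right h3

lemma aux_fix (K K₁ : Type) [Field K] [NumberField K] [Field K₁] [NumberField K₁] [Algebra K₁ K]
    [IsGalois ℚ K] [IsGalois ℚ K₁] {p : ℕ} (hp : p.Prime)
    (hd : ¬ (p : ℤ) ∣ NumberField.discr K₁) (h : aK K₁ p ≠ 0) (P : Ideal (𝓞 K))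
    [P.IsPrime] [P.LiesOver (Ideal.span {(p : ℤ)})] (σ : Gal(K/ℚ)) (hσ : σ • P = P) (x : K₁) :
    σ (algebraMap K₁ K x) = algebraMap K₁ K x := by
  have hl : (P.under (𝓞 K₁)).LiesOver (Ideal.span {(p : ℤ)}) :=
    Ideal.LiesOver.tower_bot P _ _
  have h1 := (aux_split K₁ hp hd h).1 (P.under (𝓞 K₁)) inferInstance hl
  have h2 := IsGaloisGroup.restrictHom_smul_under Gal(K/ℚ) Gal(K₁/ℚ) ℤ (𝓞 K₁) (𝓞 K) σ P
  rw [hσ] at h2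
  rw [Subgroup.card_eq_one] at h1
  have h3 : IsGaloisGroup.restrictHom Gal(K/ℚ) Gal(K₁/ℚ) ℤ (𝓞 K₁) (𝓞 K) σ = 1 := by
    rw [← Subgroup.mem_bot, ← h1]
    exact h2
  have h4 : ∀ y : 𝓞 K₁, σ (algebraMap K₁ K (algebraMap (𝓞 K₁) K₁ y)) =
      algebraMap K₁ K (algebraMap (𝓞 K₁) K₁ y) := by
    intro y
    have h5 := IsGaloisGroup.algebraMap_restrictHom_smul Gal(K/ℚ) Gal(K₁/ℚ) ℤ (𝓞 K₁) (𝓞 K) σ y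
    rw [h3, one_smul] at h5
    exact (congrArg (algebraMap (𝓞 K) K) h5).symm
  obtain ⟨a, b, -, rfl⟩ := IsFractionRing.div_surjective (A := 𝓞 K₁) x
  rw [map_div₀, map_div₀, h4, h4]

lemma aux_up (K K₁ K₂ : Type) [Field K] [NumberField K] [Field K₁] [NumberField K₁] [Algebra K₁ K]
    [Field K₂] [NumberField K₂] [Algebra K₂ K]
    [IsGalois ℚ K] [IsGalois ℚ K₁] [IsGalois ℚ K₂]
    (hgen : ∀ σ : Gal(K/ℚ), (∀ x : K₁, σ (algebraMap K₁ K x) = algebraMap K₁ K x) →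
      (∀ x : K₂, σ (algebraMap K₂ K x) = algebraMap K₂ K x) → σ = 1)
    {p : ℕ} (hp : p.Prime)
    (hd₁ : ¬ (p : ℤ) ∣ NumberField.discr K₁) (hd₂ : ¬ (p : ℤ) ∣ NumberField.discr K₂)
    (h₁ : aK K₁ p ≠ 0) (h₂ : aK K₂ p ≠ 0) : aK K p ≠ 0 := by
  have : Fact p.Prime := ⟨hp⟩
  obtain ⟨P, hP1, hP2⟩ := (inferInstance : Nonempty ((Ideal.span {(p : ℤ)}).primesOver (𝓞 K)))
  refine (aux_exists_prime K hp).2 ⟨P, hP1, hP2, ?_⟩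
  have hs : Nat.card (MulAction.stabilizer Gal(K/ℚ) P) = 1 := by
    rw [Subgroup.card_eq_one, eq_bot_iff]
    intro σ hσ
    exact hgen σ (aux_fix K K₁ hp hd₁ h₁ P σ hσ) (aux_fix K K₂ hp hd₂ h₂ P σ hσ)
  rw [Ideal.card_stabilizer_eq (Ideal.span {(p : ℤ)}) P] at hs
  rw [aux_norm_iff K hp, ← Ideal.inertiaDegIn_eq_inertiaDeg (Ideal.span {(p : ℤ)}) P Gal(K/ℚ)]
  exact Nat.eq_one_of_mul_eq_one_left hs

theorem aux_prime_identity (K K₁ K₂ : Type) [Field K] [NumberField K] [Field K₁] [NumberField K₁]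
    [Algebra K₁ K] [Field K₂] [NumberField K₂] [Algebra K₂ K]
    [IsGalois ℚ K] [IsGalois ℚ K₁] [IsGalois ℚ K₂]
    (hgen : ∀ σ : Gal(K/ℚ), (∀ x : K₁, σ (algebraMap K₁ K x) = algebraMap K₁ K x) →
      (∀ x : K₂, σ (algebraMap K₂ K x) = algebraMap K₂ K x) → σ = 1)
    (hfr : Module.finrank ℚ K = Module.finrank ℚ K₁ * Module.finrank ℚ K₂) (l : ℕ) (hl : 1 ≤ l) :
    ∃ N : ℕ, ∀ p : ℕ, p.Prime → N ≤ p →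
      aK K₁ p ^ l * aK K₂ p ^ l = (Module.finrank ℚ K) ^ (l - 1) * aK K p := by
  refine ⟨(NumberField.discr K).natAbs + (NumberField.discr K₁).natAbs +
    (NumberField.discr K₂).natAbs + 1, fun p hp hN => ?_⟩
  have key : ∀ D : ℤ, D ≠ 0 → D.natAbs < p → ¬ (p : ℤ) ∣ D := by
    intro D hD hlt hdvd
    rw [Int.natCast_dvd] at hdvd
    exact absurd (Nat.le_of_dvd (Int.natAbs_pos.2 hD) hdvd) (by omega)
  have hd := key _ (NumberField.discr_ne_zero K) (by omega)
  have hd₁ := key _ (NumberField.discr_ne_zero K₁) (by omega)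
  have hd₂ := key _ (NumberField.discr_ne_zero K₂) (by omega)
  by_cases h : aK K p = 0
  · rw [h, mul_zero]
    by_contra hne
    have h1 : aK K₁ p ≠ 0 := by
      intro h0
      rw [h0, zero_pow (by omega), zero_mul] at hne
      exact hne rfl
    have h2 : aK K₂ p ≠ 0 := by
      intro h0
      rw [h0, zero_pow (by omega), mul_zero] at hne
      exact hne rfl
    exact aux_up K K₁ K₂ hgen hp hd₁ hd₂ h1 h2 h
  · rw [(aux_split K hp hd h).2, (aux_split K₁ hp hd₁ (aux_down K K₁ hp h)).2,
      (aux_split K₂ hp hd₂ (aux_down K K₂ hp h)).2, ← mul_pow, ← hfr, ← pow_succ]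
    congr 1
    omega

end galois
/-- **Factorization of the Dirichlet series of `a_{K₁}(n)^l a_{K₂}(n)^l`.**
With `K₁, K₂ ⊆ ℚ̄`, `[K₁ : ℚ] = 2`, `K₂/ℚ` Galois of odd degree `d ≥ 3`, coprime
discriminants, and `l ≥ 1`, there is a Dirichlet series `U(s) = ∑ uₙ n^{-s}` absolutely
convergent for `Re s > 1/2` such that
`∑ a_{K₁}(n)^l a_{K₂}(n)^l n^{-s} = ζ_{K₁K₂}(s)^{(2d)^{l-1}} · U(s)` for `Re s > 1`. -/
theorem dirichlet_series_ideal_counting_factorization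
    (K₁ K₂ : IntermediateField ℚ (AlgebraicClosure ℚ))
    [NumberField ↥K₁] [NumberField ↥K₂] [NumberField ↥(K₁ ⊔ K₂)]
    (h2 : Module.finrank ℚ ↥K₁ = 2)
    [IsGalois ℚ ↥K₂]
    (d : ℕ) (hdval : d = Module.finrank ℚ ↥K₂) (hodd : Odd d) (hd3 : 3 ≤ d)
    (hcop : IsCoprime (NumberField.discr ↥K₁) (NumberField.discr ↥K₂))
    (l : ℕ) (hl : 1 ≤ l) :
    ∃ u : ℕ → ℂ,
      (∀ s : ℂ, 1 / 2 < s.re → LSeriesSummable u s) ∧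
      ∀ s : ℂ, 1 < s.re →
        LSeries (fun n => (aK ↥K₁ n : ℂ) ^ l * (aK ↥K₂ n : ℂ) ^ l) s
          = dzeta ↥(K₁ ⊔ K₂) s ^ ((2 * d) ^ (l - 1)) * LSeries u s := by
  have hq : Algebra.IsQuadraticExtension ℚ ↥K₁ := { finrank_eq_two' := h2 }
  have hg1 : IsGalois ℚ ↥K₁ := inferInstance
  have hn1 : @Normal ℚ ↥K₁ _ _ K₁.algebra' := by
    convert hg1.to_normal
    exact Subsingleton.elim _ _
  have hn2 : @Normal ℚ ↥K₂ _ _ K₂.algebra' := by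
    convert (inferInstance : IsGalois ℚ ↥K₂).to_normal
    exact Subsingleton.elim _ _
  have hn : Normal ℚ ↥(K₁ ⊔ K₂) := by
    convert @IntermediateField.normal_sup ℚ (AlgebraicClosure ℚ) _ _ _ K₁ K₂ hn1 hn2
    exact Subsingleton.elim _ _
  have hg : IsGalois ℚ ↥(K₁ ⊔ K₂) := {}
  let _ : Algebra ↥K₁ ↥(K₁ ⊔ K₂) :=
    (IntermediateField.inclusion (le_sup_left : K₁ ≤ K₁ ⊔ K₂)).toRingHom.toAlgebra
  let _ : Algebra ↥K₂ ↥(K₁ ⊔ K₂) :=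
    (IntermediateField.inclusion (le_sup_right : K₂ ≤ K₁ ⊔ K₂)).toRingHom.toAlgebra
  have hfr : Module.finrank ℚ ↥(K₁ ⊔ K₂) = Module.finrank ℚ ↥K₁ * Module.finrank ℚ ↥K₂ := by
    refine (IntermediateField.LinearDisjoint.of_finrank_coprime ?_).finrank_sup
    rw [h2, ← hdval]
    exact (Nat.coprime_two_left).2 hodd
  obtain ⟨N, hN⟩ := aux_prime_identity ↥(K₁ ⊔ K₂) ↥K₁ ↥K₂ (by
    intro σ hσ1 hσ2
    have key : ∀ (x : AlgebraicClosure ℚ) (hx : x ∈ K₁ ⊔ K₂), σ ⟨x, hx⟩ = ⟨x, hx⟩ := by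
      intro x hx
      refine IntermediateField.adjoin_induction ℚ (s := (K₁ ∪ K₂ : Set (AlgebraicClosure ℚ)))
        (p := fun x hx => σ (⟨x, hx⟩ : ↥(K₁ ⊔ K₂)) = ⟨x, hx⟩) ?_ ?_ ?_ ?_ ?_ hx
      · rintro x (hx | hx)
        · exact hσ1 ⟨x, hx⟩
        · exact hσ2 ⟨x, hx⟩
      · intro q
        exact σ.commutes q
      · intro x y hx hy h1 h2
        have := map_add σ (⟨x, hx⟩ : ↥(K₁ ⊔ K₂)) ⟨y, hy⟩
        rw [h1, h2] at this
        exact this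
      · intro x hx h1
        have := map_inv₀ σ (⟨x, hx⟩ : ↥(K₁ ⊔ K₂))
        rw [h1] at this
        exact this
      · intro x y hx hy h1 h2
        have := map_mul σ (⟨x, hx⟩ : ↥(K₁ ⊔ K₂)) ⟨y, hy⟩
        rw [h1, h2] at this
        exact this
    exact AlgEquiv.ext fun x => key x.1 x.2) hfr l hl
  rw [hfr, h2, ← hdval] at hN
  exact aux_main ↥(K₁ ⊔ K₂) ↥K₁ ↥K₂ l _ N hN hl
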